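/- arXiv:1911.01880 — 6 statements merged into one kernel-verified Lean document; each statement's English description precedes it below -/
import Mathlib

section
/- Let (t_j) be a sequence of real numbers with |t_j| → ∞ and let (X_j) be a sequence of positive real numbers. Then the following are equivalent: (i) X_j/(1+|t_j|) → ∞ as j → ∞; (ii) for every sequence (y_j) of nonzero real numbers satisfying |y_j − 1| < 1/X_j for all j, one has |y_j|^{i t_j} → 1 in ℂ, i.e. exp(i·t_j·log|y_j|) converges to 1. -/
open Filter

lemma abs_log_abs_le_two_mul_abs_sub_one {y : ℝ} (hy : |y - 1| ≤ 1 / 2) :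
    |Real.log (|y|)| ≤ 2 * |y - 1| := by
  have h := abs_le.mp hy
  have hpos : 0 < y := by linarith
  rw [abs_of_pos hpos]
  have hlower := Real.one_sub_inv_le_log_of_pos hpos
  have hupper := Real.log_le_sub_one_of_pos hpos
  have hinv : y⁻¹ - 1 ≤ 2 * |y - 1| := by
    rw [show y⁻¹ - 1 = (1 - y) / y by field_simp, div_le_iff₀ hpos]
    nlinarith [neg_abs_le (y - 1), abs_nonneg (y - 1)]
  rw [abs_le]
  constructor <;> linarith [le_abs_self (y - 1), abs_nonneg (y - 1)]

lemma Complex.exp_I_mul_ofReal_ne_one {δ : ℝ} (hpos : 0 < δ) (hle : δ ≤ 1) :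
    Complex.exp (Complex.I * (δ : ℂ)) ≠ 1 := by
  intro h
  have him := congrArg Complex.im h
  rw [mul_comm, Complex.exp_ofReal_mul_I_im, Complex.one_im] at him
  exact (Real.sin_pos_of_pos_of_le_one hpos hle).ne' him

/-- Toy Theorem: for a sequence of real numbers `t j` with `|t j| → ∞` and positive
scaling parameters `X j`, the condition `X j / (1 + |t j|) → ∞` is equivalent to the
approximate invariance of the character `|·|^{i t_j}`: for every sequence of nonzero
reals `y j` with `|y j - 1| < 1 / X j`, the complex numbers
`|y j|^{i t_j} = exp(i · t_j · log |y j|)` tend to `1`. -/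
theorem toy_theorem (t X : ℕ → ℝ)
    (ht : Tendsto (fun j => |t j|) atTop atTop)
    (hX : ∀ j, 0 < X j) :
    Tendsto (fun j => X j / (1 + |t j|)) atTop atTop ↔
      ∀ y : ℕ → ℝ, (∀ j, y j ≠ 0) → (∀ j, |y j - 1| < 1 / X j) →
        Tendsto (fun j => Complex.exp (Complex.I * (t j : ℂ) * (Real.log |y j| : ℂ)))
          atTop (nhds 1) := by
  constructor
  · intro h y _ hy
    have hphase : Tendsto (fun j => t j * Real.log |y j|) atTop (nhds 0) := by
      have hbound : Tendsto (fun j => 2 * (X j / (1 + |t j|))⁻¹) atTop (nhds 0) := by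
        simpa using h.inv_tendsto_atTop.const_mul 2
      refine squeeze_zero_norm' ?_ hbound
      filter_upwards [h.eventually_ge_atTop 2] with j hj
      have ht0 := abs_nonneg (t j)
      rw [le_div_iff₀ (by positivity)] at hj
      have hsmall : 1 / X j ≤ 1 / 2 := one_div_le_one_div_of_le two_pos (by linarith)
      have hlog := abs_log_abs_le_two_mul_abs_sub_one ((hy j).le.trans hsmall)
      rw [Real.norm_eq_abs, abs_mul, inv_div]
      calc |t j| * |Real.log (|y j|)| ≤ (1 + |t j|) * (2 * (1 / X j)) := by
            gcongr
            · linarith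
            · linarith [hy j]
        _ = 2 * ((1 + |t j|) / X j) := by ring
    have hcont : Continuous fun x : ℝ => Complex.exp (Complex.I * (x : ℂ)) := by fun_prop
    simpa [Function.comp_def, mul_assoc] using (hcont.tendsto 0).comp hphase
  · intro h
    rw [tendsto_atTop]
    intro b
    obtain ⟨B, hB1, hBb⟩ : ∃ B : ℝ, 1 ≤ B ∧ b ≤ B := ⟨max b 1, le_max_right _ _, le_max_left _ _⟩
    obtain ⟨δ, hδ⟩ : ∃ δ : ℝ, δ = 1 / (4 * B) := ⟨_, rfl⟩
    have hδpos : 0 < δ := by rw [hδ]; positivity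
    have hδB : 4 * B * δ = 1 := by rw [hδ]; field_simp
    have hδle : δ ≤ 1 := by nlinarith
    classical
    let y : ℕ → ℝ := fun j =>
      if |Real.exp (δ / t j) - 1| < 1 / X j then Real.exp (δ / t j) else 1
    have hlim := h y
      (fun j => by
        dsimp only [y]
        split_ifs
        · exact (Real.exp_pos _).ne'
        · exact one_ne_zero)
      (fun j => by
        dsimp only [y]
        split_ifs with hj
        · exact hj
        · simpa using hX j)
    filter_upwards [hlim.eventually_ne (Complex.exp_I_mul_ofReal_ne_one hδpos hδle).symm,
      ht.eventually_ge_atTop 1] with j hne htj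
    have htne : t j ≠ 0 := abs_pos.mp (by linarith)
    have hfail : ¬ |Real.exp (δ / t j) - 1| < 1 / X j := by
      intro hj
      apply hne
      have hphase : t j * Real.log |y j| = δ := by
        simp only [y, if_pos hj, Real.abs_exp, Real.log_exp]
        field_simp
      rw [mul_assoc, ← Complex.ofReal_mul, hphase]
    have hs : |δ / t j| ≤ 1 := by
      rw [abs_div, abs_of_pos hδpos, div_le_one (by linarith)]
      linarith
    have hexp := (not_lt.mp hfail).trans (Real.abs_exp_sub_one_le hs)
    rw [abs_div, abs_of_pos hδpos, mul_div_assoc', div_le_div_iff₀ (hX j) (by linarith)] at hexp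
    rw [le_div_iff₀ (by positivity)]
    calc b * (1 + |t j|) ≤ B * (|t j| + |t j|) := by gcongr
      _ = 2 * B * (1 * |t j|) := by ring
      _ ≤ 2 * B * (2 * δ * X j) := by gcongr
      _ = 4 * B * δ * X j := by ring
      _ = X j := by rw [hδB, one_mul]
end

section
/- Fix an integer n ≥ 2. For all τ₀ ∈ (0, 1/(2n)) and δ ∈ (0,1) there exists τ₁ ∈ (0, τ₀) such that for all real X ≥ 1 and all g ∈ K₀(X, τ₁), setting A = K₀(X, τ₀), one has μ(gA △ A) < δ·μ(A), where gA = {g·h : h ∈ A} and △ denotes symmetric difference of sets. -/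
open MeasureTheory

noncomputable section

/-- The archimedean congruence subset `K₀(X,τ)` inside `GL_n(ℝ)`, encoded as a set of
`n × n` real matrices (given as functions): in block form `[[a,b],[c,d]]` with `a` of
size `(n-1) × (n-1)`, the matrix and its top-left block are invertible,
`|a - 1| < τ`, `|b| < τ`, `|c| < τ/X` and `|d - 1| < τ` entrywise. -/
def K0 (n : ℕ) (X τ : ℝ) : Set (Fin n → Fin n → ℝ) :=
  {g | IsUnit (Matrix.of g).det ∧
       IsUnit (Matrix.of fun i j : Fin (n - 1) =>
         g (Fin.castLE (Nat.sub_le n 1) i) (Fin.castLE (Nat.sub_le n 1) j)).det ∧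
       (∀ i j : Fin n, i.val < n - 1 → j.val < n - 1 →
          |g i j - (if i = j then 1 else 0)| < τ) ∧
       (∀ i j : Fin n, i.val < n - 1 → j.val = n - 1 → |g i j| < τ) ∧
       (∀ i j : Fin n, i.val = n - 1 → j.val < n - 1 → |g i j| < τ / X) ∧
       (∀ i j : Fin n, i.val = n - 1 → j.val = n - 1 → |g i j - 1| < τ)}

/-- The Haar measure on `GL_n(ℝ)`, given by the density `|det g|^{-n}` with respect to
Lebesgue measure on the matrix entries. -/
def muGL (n : ℕ) : Measure (Fin n → Fin n → ℝ) :=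
  volume.withDensity fun g => ENNReal.ofReal (1 / |(Matrix.of g).det| ^ n)

/-- Matrix multiplication on matrices encoded as functions. -/
def mulG (n : ℕ) (g h : Fin n → Fin n → ℝ) : Fin n → Fin n → ℝ :=
  fun i j => ∑ k, g i k * h k j

/-- The box of matrices `h` with `|h i j - 1 i j| < t * e i j` for all `i j`. -/
def weightedBox {n : ℕ} (e : Fin n → Fin n → ℝ) (t : ℝ) : Set (Fin n → Fin n → ℝ) :=
  {h | ∀ i j, |h i j - (if i = j then 1 else 0)| < t * e i j}

/-- Weights `e` for which the matrices dominated entrywise by `e` are, up to a constant, stable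
under multiplication. -/
structure IsSubmulWeight {n : ℕ} (e : Fin n → Fin n → ℝ) : Prop where
  pos : ∀ i j, 0 < e i j
  le_one : ∀ i j, e i j ≤ 1
  diag : ∀ i, e i i = 1
  mul_le : ∀ i k j, e i k * e k j ≤ e i j

/-- The weight `1 / X` on the last row off the diagonal and `1` elsewhere. -/
def lastRowWeight (n : ℕ) (X : ℝ) (i j : Fin n) : ℝ :=
  if i.val = n - 1 ∧ j.val < n - 1 then 1 / X else 1

theorem lastRowWeight_eq_one {n : ℕ} {X : ℝ} {i j : Fin n}
    (h : ¬ (i.val = n - 1 ∧ j.val < n - 1)) : lastRowWeight n X i j = 1 := if_neg h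

theorem lastRowWeight_eq_one_div {n : ℕ} {X : ℝ} {i j : Fin n}
    (hi : i.val = n - 1) (hj : j.val < n - 1) : lastRowWeight n X i j = 1 / X := if_pos ⟨hi, hj⟩

theorem isSubmulWeight_lastRowWeight {n : ℕ} {X : ℝ} (hX : 1 ≤ X) :
    IsSubmulWeight (lastRowWeight n X) := by
  have hX0 : 0 < 1 / X := by positivity
  have hX1 : 1 / X ≤ 1 := by rw [div_le_one (by linarith)]; exact hX
  refine ⟨fun i j => ?_, fun i j => ?_, fun i => ?_, fun i k j => ?_⟩
  · unfold lastRowWeight; split_ifs <;> linarith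
  · unfold lastRowWeight; split_ifs <;> linarith
  · unfold lastRowWeight; rw [if_neg (by omega)]
  · have := k.isLt
    unfold lastRowWeight
    split_ifs <;> first | omega | nlinarith

theorem det_ne_zero_of_abs_sub_one_lt {m : ℕ} (M : Matrix (Fin m) (Fin m) ℝ) {s : ℝ}
    (hs : m * s < 1) (hM : ∀ i j, |M i j - (if i = j then 1 else 0)| ≤ s) : M.det ≠ 0 := by
  apply det_ne_zero_of_sum_row_lt_diag
  intro k
  have h1 : ∑ j ∈ Finset.univ.erase k, ‖M k j‖ ≤ ∑ _j ∈ Finset.univ.erase k, s := by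
    refine Finset.sum_le_sum fun j hj => ?_
    have := hM k j
    rwa [if_neg (Finset.ne_of_mem_erase hj).symm, sub_zero] at this
  have h2 := hM k k
  rw [if_pos rfl] at h2
  rw [Finset.sum_const, Finset.card_erase_of_mem (Finset.mem_univ k), Finset.card_univ,
    Fintype.card_fin, nsmul_eq_mul, Nat.cast_sub (by have := k.isLt; omega)] at h1
  rw [Real.norm_eq_abs (M k k)]
  have h3 := (abs_le.1 h2).1
  have h4 := le_abs_self (M k k)
  push_cast at h1
  linarith

section weightedBox

variable {n : ℕ} {e : Fin n → Fin n → ℝ}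

theorem weightedBox_mono (he : IsSubmulWeight e) {s t : ℝ} (hst : s ≤ t) :
    weightedBox e s ⊆ weightedBox e t := fun _ hh i j =>
  (hh i j).trans_le (mul_le_mul_of_nonneg_right hst (he.pos i j).le)

theorem abs_sub_one_le_of_mem_weightedBox (he : IsSubmulWeight e) {t : ℝ} (ht : 0 ≤ t)
    {h : Fin n → Fin n → ℝ} (hh : h ∈ weightedBox e t) (i j : Fin n) :
    |h i j - (if i = j then 1 else 0)| ≤ t :=
  (hh i j).le.trans (mul_le_of_le_one_right ht (he.le_one i j))

theorem abs_le_of_mem_weightedBox (he : IsSubmulWeight e) {t : ℝ} (ht : t ≤ 1)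
    {h : Fin n → Fin n → ℝ} (hh : h ∈ weightedBox e t) (i j : Fin n) :
    |h i j| ≤ 2 * e i j := by
  have h1 := hh i j
  have h2 : |(if i = j then (1 : ℝ) else 0)| ≤ e i j := by
    split_ifs with hij
    · subst hij; simp [he.diag]
    · simpa using (he.pos i j).le
  have h3 := abs_sub_abs_le_abs_sub (h i j) (if i = j then 1 else 0)
  have h4 := mul_le_mul_of_nonneg_right ht (he.pos i j).le
  linarith

theorem abs_mulG_sub_le (he : IsSubmulWeight e) {s M : ℝ} (hM : 0 ≤ M)
    {g k : Fin n → Fin n → ℝ} (hg : g ∈ weightedBox e s) (hk : ∀ i j, |k i j| ≤ M * e i j)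
    (i j : Fin n) : |mulG n g k i j - k i j| ≤ n * s * M * e i j := by
  have h1 : mulG n g k i j - k i j = ∑ l, (g i l - (if i = l then 1 else 0)) * k l j := by
    simp [mulG, sub_mul, Finset.sum_sub_distrib]
  have hs : 0 ≤ s := by
    have := (abs_nonneg _).trans_lt (hg i i)
    rw [he.diag, mul_one] at this
    exact this.le
  rw [h1]
  refine (Finset.abs_sum_le_sum_abs _ _).trans ?_
  have h2 : ∀ l ∈ Finset.univ, |(g i l - (if i = l then 1 else 0)) * k l j|
      ≤ s * M * e i j := fun l _ => by
    rw [abs_mul]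
    calc _ ≤ (s * e i l) * (M * e l j) :=
          mul_le_mul (hg i l).le (hk l j) (abs_nonneg _) (mul_nonneg hs (he.pos i l).le)
      _ = s * M * (e i l * e l j) := by ring
      _ ≤ _ := mul_le_mul_of_nonneg_left (he.mul_le i l j) (mul_nonneg hs hM)
  refine (Finset.sum_le_sum h2).trans_eq ?_
  rw [Finset.sum_const, Finset.card_univ, Fintype.card_fin, nsmul_eq_mul]
  ring

theorem mulG_mem_weightedBox (he : IsSubmulWeight e) {s t : ℝ} (ht : t ≤ 1)
    {g h : Fin n → Fin n → ℝ} (hg : g ∈ weightedBox e s) (hh : h ∈ weightedBox e t) :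
    mulG n g h ∈ weightedBox e (t + 2 * n * s) := fun i j => by
  have h1 := abs_mulG_sub_le he zero_le_two hg (abs_le_of_mem_weightedBox he ht hh) i j
  have h2 := abs_sub_le (mulG n g h i j) (h i j) (if i = j then 1 else 0)
  have h3 := hh i j
  linarith

theorem abs_le_of_mulG_mem_weightedBox (he : IsSubmulWeight e) {s t : ℝ} (ht : t ≤ 1)
    (hs : n * s ≤ 1 / 2) {g k : Fin n → Fin n → ℝ} (hg : g ∈ weightedBox e s)
    (hk : mulG n g k ∈ weightedBox e t) (i j : Fin n) : |k i j| ≤ 4 * e i j := by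
  have : Nonempty (Fin n × Fin n) := ⟨(i, j)⟩
  obtain ⟨⟨p, q⟩, hpq⟩ := Finite.exists_max fun x : Fin n × Fin n => |k x.1 x.2| / e x.1 x.2
  set M := |k p q| / e p q
  have hM0 : 0 ≤ M := div_nonneg (abs_nonneg _) (he.pos p q).le
  have hM : ∀ i j, |k i j| ≤ M * e i j := fun i j => (div_le_iff₀ (he.pos i j)).1 (hpq (i, j))
  have h1 := abs_mulG_sub_le he hM0 hg hM p q
  have h2 := abs_le_of_mem_weightedBox he ht hk p q
  have h3 := abs_sub_abs_le_abs_sub (k p q) (mulG n g k p q)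
  rw [abs_sub_comm] at h3
  have h4 : |k p q| = M * e p q := (div_mul_cancel₀ _ (he.pos p q).ne').symm
  have h5 : M * e p q ≤ (2 + n * s * M) * e p q := by linarith
  have h6 := le_of_mul_le_mul_right h5 (he.pos p q)
  have h7 := mul_le_mul_of_nonneg_right hs hM0
  exact (hM i j).trans (mul_le_mul_of_nonneg_right (by linarith) (he.pos i j).le)

theorem mem_weightedBox_of_mulG_mem (he : IsSubmulWeight e) {s t : ℝ} (ht : t ≤ 1)
    (hs : n * s ≤ 1 / 2) {g k : Fin n → Fin n → ℝ} (hg : g ∈ weightedBox e s)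
    (hk : mulG n g k ∈ weightedBox e t) : k ∈ weightedBox e (t + 4 * n * s) := fun i j => by
  have h1 := abs_mulG_sub_le he zero_le_four hg
    (abs_le_of_mulG_mem_weightedBox he ht hs hg hk) i j
  rw [abs_sub_comm] at h1
  have h2 := abs_sub_le (k i j) (mulG n g k i j) (if i = j then 1 else 0)
  have h3 := hk i j
  linarith

theorem weightedBox_eq_pi (e : Fin n → Fin n → ℝ) (t : ℝ) :
    weightedBox e t = Set.univ.pi fun i => Set.univ.pi fun j =>
      Metric.ball (if i = j then (1 : ℝ) else 0) (t * e i j) := by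
  ext h
  simp [weightedBox, Real.dist_eq]

theorem measurableSet_weightedBox (e : Fin n → Fin n → ℝ) (t : ℝ) :
    MeasurableSet (weightedBox e t) := by
  rw [weightedBox_eq_pi]
  exact .univ_pi fun _ => .univ_pi fun _ => measurableSet_ball

theorem volume_weightedBox (he : IsSubmulWeight e) {t : ℝ} (ht : 0 ≤ t) :
    volume (weightedBox e t) = ENNReal.ofReal (t ^ (n * n) * ∏ i, ∏ j, 2 * e i j) := by
  have hp : ∀ i j, 0 ≤ 2 * (t * e i j) := fun i j =>
    mul_nonneg zero_le_two (mul_nonneg ht (he.pos i j).le)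
  simp_rw [weightedBox_eq_pi, volume_pi_pi, Real.volume_ball]
  simp_rw [← ENNReal.ofReal_prod_of_nonneg fun j _ => hp _ j]
  rw [← ENNReal.ofReal_prod_of_nonneg fun i _ => Finset.prod_nonneg fun j _ => hp i j]
  simp_rw [mul_left_comm (2 : ℝ) t, Finset.prod_mul_distrib (f := fun _ => t)]
  simp [Finset.prod_mul_distrib, pow_mul]

theorem weightedBox_subset_closedBall (he : IsSubmulWeight e) {t : ℝ} (ht : 0 ≤ t) :
    weightedBox e t ⊆
      Metric.closedBall (fun i j : Fin n => if i = j then (1 : ℝ) else 0) t := fun h hh => by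
  rw [Metric.mem_closedBall, dist_pi_le_iff ht]
  intro i
  rw [dist_pi_le_iff ht]
  exact abs_sub_one_le_of_mem_weightedBox he ht hh i

end weightedBox

theorem K0_subset_weightedBox (n : ℕ) (X τ : ℝ) :
    K0 n X τ ⊆ weightedBox (lastRowWeight n X) τ := by
  rintro g ⟨-, -, h1, h2, h3, h4⟩ i j
  have hi : i.val < n - 1 ∨ i.val = n - 1 := by omega
  have hj : j.val < n - 1 ∨ j.val = n - 1 := by omega
  rcases hi with hi | hi <;> rcases hj with hj | hj
  · rw [lastRowWeight_eq_one (by omega), mul_one]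
    exact h1 i j hi hj
  · rw [lastRowWeight_eq_one (by omega), mul_one, if_neg (by omega), sub_zero]
    exact h2 i j hi hj
  · rw [lastRowWeight_eq_one_div hi hj, if_neg (by omega), sub_zero, mul_one_div]
    exact h3 i j hi hj
  · rw [lastRowWeight_eq_one (by omega), mul_one, if_pos (by omega)]
    exact h4 i j hi hj

theorem K0_eq_weightedBox {n : ℕ} {X τ : ℝ} (hX : 1 ≤ X) (hτ : 0 ≤ τ) (hnτ : n * τ < 1) :
    K0 n X τ = weightedBox (lastRowWeight n X) τ := by
  refine (K0_subset_weightedBox n X τ).antisymm fun g hg => ?_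
  have hle := abs_sub_one_le_of_mem_weightedBox (isSubmulWeight_lastRowWeight hX) hτ hg
  refine ⟨?_, ?_, fun i j hi hj => ?_, fun i j hi hj => ?_, fun i j hi hj => ?_,
    fun i j hi hj => ?_⟩
  · exact (det_ne_zero_of_abs_sub_one_lt _ hnτ hle).isUnit
  · refine (det_ne_zero_of_abs_sub_one_lt (s := τ) _ (lt_of_le_of_lt ?_ hnτ)
      fun i j => ?_).isUnit
    · exact mul_le_mul_of_nonneg_right (by exact_mod_cast Nat.sub_le n 1) hτ
    · simpa using hle (Fin.castLE (Nat.sub_le n 1) i) (Fin.castLE (Nat.sub_le n 1) j)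
  · have := hg i j
    rwa [lastRowWeight_eq_one (by omega), mul_one] at this
  · have := hg i j
    rwa [lastRowWeight_eq_one (by omega), mul_one,
      if_neg (by omega), sub_zero] at this
  · have := hg i j
    rwa [lastRowWeight_eq_one_div hi hj,
      if_neg (by omega), sub_zero, mul_one_div] at this
  · have := hg i j
    rwa [lastRowWeight_eq_one (by omega), mul_one,
      if_pos (by omega)] at this

/-- Near the identity, the Haar density is bounded above and away from zero. -/
theorem exists_muGL_bounds {n : ℕ} {r : ℝ} (hr : 0 ≤ r) (hnr : n * r < 1) :
    ∃ c C : ℝ, 0 < c ∧ 0 < C ∧ ∀ S : Set (Fin n → Fin n → ℝ), MeasurableSet S →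
      S ⊆ Metric.closedBall (fun i j : Fin n => if i = j then (1 : ℝ) else 0) r →
      ENNReal.ofReal c * volume S ≤ muGL n S ∧ muGL n S ≤ ENNReal.ofReal C * volume S := by
  set K := Metric.closedBall (fun i j : Fin n => if i = j then (1 : ℝ) else 0) r
  have hdet : ∀ g ∈ K, 0 < |(Matrix.of g).det| ^ n := fun g hg => by
    refine pow_pos (abs_pos.2 (det_ne_zero_of_abs_sub_one_lt _ hnr fun i j => ?_)) n
    exact (dist_le_pi_dist _ _ j).trans ((dist_le_pi_dist _ _ i).trans hg)
  have hcont : Continuous fun g : Fin n → Fin n → ℝ => |(Matrix.of g).det| ^ n :=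
    ((Continuous.matrix_det (A := fun g : Fin n → Fin n → ℝ => Matrix.of g)
      continuous_id).abs).pow n
  have hf : ContinuousOn (fun g : Fin n → Fin n → ℝ => 1 / |(Matrix.of g).det| ^ n) K :=
    continuousOn_const.div hcont.continuousOn fun g hg => (hdet g hg).ne'
  have hK : IsCompact K := isCompact_closedBall _ _
  have hne : K.Nonempty := Metric.nonempty_closedBall.2 hr
  obtain ⟨a, ha, hmin⟩ := hK.exists_isMinOn hne hf
  obtain ⟨b, hb, hmax⟩ := hK.exists_isMaxOn hne hf
  refine ⟨_, _, one_div_pos.2 (hdet a ha), one_div_pos.2 (hdet b hb), fun S hS hSK => ?_⟩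
  rw [muGL, withDensity_apply _ hS, ← setLIntegral_const, ← setLIntegral_const]
  exact ⟨setLIntegral_mono' hS fun x hx => ENNReal.ofReal_le_ofReal (hmin (hSK hx)),
    setLIntegral_mono' hS fun x hx => ENNReal.ofReal_le_ofReal (hmax (hSK hx))⟩

theorem symmDiff_image_mulG_subset {n : ℕ} {e : Fin n → Fin n → ℝ} (he : IsSubmulWeight e)
    {s t : ℝ} (hs0 : 0 ≤ s) (hs : n * s ≤ 1 / 2) (ht : t ≤ 1)
    {g : Fin n → Fin n → ℝ} (hg : g ∈ weightedBox e s) :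
    symmDiff (mulG n g '' weightedBox e t) (weightedBox e t) ⊆
      weightedBox e (t + 4 * n * s) \ weightedBox e (t - 4 * n * s) := by
  have hns : 0 ≤ n * s := by positivity
  have hdet : (Matrix.of g).det ≠ 0 := det_ne_zero_of_abs_sub_one_lt _ (by linarith)
    (abs_sub_one_le_of_mem_weightedBox he hs0 hg)
  have himage : mulG n g '' weightedBox e t ⊆ weightedBox e (t + 4 * n * s) := by
    rintro _ ⟨h, hh, rfl⟩
    exact weightedBox_mono he (by linarith) (mulG_mem_weightedBox he ht hg hh)
  have hsub : weightedBox e (t - 4 * n * s) ⊆ mulG n g '' weightedBox e t := fun x hx => by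
    have hmul : mulG n g ((Matrix.of g)⁻¹ * Matrix.of x) = x := by
      change Matrix.of g * ((Matrix.of g)⁻¹ * Matrix.of x) = Matrix.of x
      exact Matrix.mul_nonsing_inv_cancel_left _ _ hdet.isUnit
    refine ⟨_, ?_, hmul⟩
    rw [← hmul] at hx
    simpa using mem_weightedBox_of_mulG_mem he (by linarith) hs hg hx
  have hlt : weightedBox e (t - 4 * n * s) ⊆ weightedBox e t :=
    weightedBox_mono he (by linarith)
  have hgt : weightedBox e t ⊆ weightedBox e (t + 4 * n * s) :=
    weightedBox_mono he (by linarith)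
  rintro x (⟨h1, h2⟩ | ⟨h1, h2⟩)
  · exact ⟨himage h1, fun h => h2 (hlt h)⟩
  · exact ⟨hgt h1, fun h => h2 (hsub h)⟩

open Filter Topology in
theorem exists_pos_mul_pow_sub_pow_lt (N : ℕ) (C a : ℝ) {t b d : ℝ} (hb : 0 < b) (hd : 0 < d) :
    ∃ s, 0 < s ∧ s < d ∧ C * ((t + a * s) ^ N - (t - a * s) ^ N) < b := by
  have hcont : Continuous fun s : ℝ => C * ((t + a * s) ^ N - (t - a * s) ^ N) := by fun_prop
  have h1 : ∀ᶠ s in 𝓝 (0 : ℝ), C * ((t + a * s) ^ N - (t - a * s) ^ N) < b :=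
    hcont.continuousAt.eventually_lt continuousAt_const (by simpa using hb)
  have h2 : ∀ᶠ s in 𝓝[>] (0 : ℝ), 0 < s ∧ s < d := Ioo_mem_nhdsGT hd
  obtain ⟨s, ⟨hs0, hsd⟩, hs⟩ := (h2.and (h1.filter_mono nhdsWithin_le_nhds)).exists
  exact ⟨s, hs0, hsd, hs⟩

/-- Følner-type property of the congruence subsets `K₀(X,τ)` (Lemma 1.2, case `* = 0`):
for all `τ₀ ∈ (0, 1/(2n))` and `δ ∈ (0,1)` there is `τ₁ ∈ (0,τ₀)` so that for all
`X ≥ 1` and `g ∈ K₀(X,τ₁)`, the set `A = K₀(X,τ₀)` satisfies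
`μ(gA △ A) < δ · μ(A)`. -/
theorem folner_K0 (n : ℕ) (hn : 2 ≤ n) (τ₀ δ : ℝ)
    (hτ₀ : 0 < τ₀) (hτ₀' : τ₀ < 1 / (2 * (n : ℝ))) (hδ : 0 < δ) (hδ' : δ < 1) :
    ∃ τ₁ : ℝ, 0 < τ₁ ∧ τ₁ < τ₀ ∧ ∀ X : ℝ, 1 ≤ X → ∀ g ∈ K0 n X τ₁,
      muGL n (symmDiff ((mulG n g) '' K0 n X τ₀) (K0 n X τ₀)) <
        ENNReal.ofReal δ * muGL n (K0 n X τ₀) := by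
  have hn1 : (2 : ℝ) ≤ n := by exact_mod_cast hn
  have hn0 : (0 : ℝ) < n := by linarith
  set r : ℝ := 1 / (2 * n) with hr
  have hr0 : 0 < r := by positivity
  have hnr : n * r = 1 / 2 := by rw [hr]; field_simp
  have hnτ : n * τ₀ < 1 / 2 := by rw [← hnr]; exact mul_lt_mul_of_pos_left hτ₀' hn0
  have hτ1 : τ₀ ≤ 1 := by nlinarith
  obtain ⟨c, C, hc, hC, hbounds⟩ := exists_muGL_bounds (n := n) hr0.le (by linarith)
  obtain ⟨s, hs0, hsd, hs⟩ := exists_pos_mul_pow_sub_pow_lt (n * n) C (4 * n) (t := τ₀)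
    (b := δ * (c * τ₀ ^ (n * n))) (d := min τ₀ (r - τ₀) / (4 * n)) (by positivity)
    (div_pos (lt_min hτ₀ (sub_pos.2 hτ₀')) (by positivity))
  rw [lt_div_iff₀ (by positivity), mul_comm] at hsd
  have hs1 := hsd.trans_le (min_le_left _ _)
  have hs2 := hsd.trans_le (min_le_right _ _)
  have hs4 : 0 < 4 * n * s := by positivity
  have hsτ : s < τ₀ := by nlinarith
  refine ⟨s, hs0, hsτ, fun X hX g hg => ?_⟩
  have he := isSubmulWeight_lastRowWeight (n := n) hX
  rw [K0_eq_weightedBox hX hτ₀.le (by linarith)]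
  set e := lastRowWeight n X
  set V : ℝ := ∏ i, ∏ j, 2 * e i j
  have hV : 0 < V := Finset.prod_pos fun i _ => Finset.prod_pos fun j _ =>
    mul_pos two_pos (he.pos i j)
  have hA := (hbounds _ (measurableSet_weightedBox e τ₀)
    ((weightedBox_subset_closedBall he hτ₀.le).trans
      (Metric.closedBall_subset_closedBall hτ₀'.le))).1
  rw [volume_weightedBox he hτ₀.le, ← ENNReal.ofReal_mul hc.le] at hA
  have hD := (hbounds (weightedBox e (τ₀ + 4 * n * s) \ weightedBox e (τ₀ - 4 * n * s))
    ((measurableSet_weightedBox _ _).diff (measurableSet_weightedBox _ _))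
    (Set.sdiff_subset.trans ((weightedBox_subset_closedBall he (by positivity)).trans
      (Metric.closedBall_subset_closedBall (by linarith))))).2
  rw [measure_sdiff (μ := volume) (weightedBox_mono he (by linarith))
      (measurableSet_weightedBox _ _).nullMeasurableSet
      (by rw [volume_weightedBox he (by linarith)]; exact ENNReal.ofReal_ne_top),
    volume_weightedBox he (by linarith), volume_weightedBox he (by positivity),
    ← ENNReal.ofReal_sub _ (mul_nonneg (pow_nonneg (by linarith) _) hV.le),
    ← ENNReal.ofReal_mul hC.le] at hD
  calc _ ≤ _ := measure_mono (symmDiff_image_mulG_subset he hs0.le (by nlinarith) hτ1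
        (K0_subset_weightedBox n X s hg))
    _ ≤ _ := hD
    _ < ENNReal.ofReal (δ * (c * (τ₀ ^ (n * n) * V))) := by
        rw [ENNReal.ofReal_lt_ofReal_iff (by positivity)]
        have := mul_lt_mul_of_pos_right hs hV
        linarith
    _ = ENNReal.ofReal δ * ENNReal.ofReal (c * (τ₀ ^ (n * n) * V)) := ENNReal.ofReal_mul hδ.le
    _ ≤ _ := mul_le_mul_right hA _
end
end

section
/- Fix an integer n ≥ 2. For all τ₀ ∈ (0, 1/(2n)) and δ ∈ (0,1) there exists τ₁ ∈ (0, τ₀) such that for all real X ≥ 1 and all g ∈ K₁(X, τ₁), setting A = K₁(X, τ₀), one has μ(gA △ A) < δ·μ(A), where gA = {g·h : h ∈ A} and △ denotes symmetric difference of sets. -/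
open MeasureTheory

noncomputable section

/-- The archimedean congruence subset `K₁(X,τ)` inside `GL_n(ℝ)`, encoded as a set of
`n × n` real matrices (given as functions): in block form `[[a,b],[c,d]]` with `a` of
size `(n-1) × (n-1)`, the matrix and its top-left block are invertible,
`|a - 1| < τ`, `|b| < τ`, `|c| < τ/X` and `|d - 1| < τ/X` entrywise. -/
def K1 (n : ℕ) (X τ : ℝ) : Set (Fin n → Fin n → ℝ) :=
  {g | IsUnit (Matrix.of g).det ∧
       IsUnit (Matrix.of fun i j : Fin (n - 1) =>
         g (Fin.castLE (Nat.sub_le n 1) i) (Fin.castLE (Nat.sub_le n 1) j)).det ∧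
       (∀ i j : Fin n, i.val < n - 1 → j.val < n - 1 →
          |g i j - (if i = j then 1 else 0)| < τ) ∧
       (∀ i j : Fin n, i.val < n - 1 → j.val = n - 1 → |g i j| < τ) ∧
       (∀ i j : Fin n, i.val = n - 1 → j.val < n - 1 → |g i j| < τ / X) ∧
       (∀ i j : Fin n, i.val = n - 1 → j.val = n - 1 → |g i j - 1| < τ / X)}

/-- The box of matrices whose distance to the identity is less than `r * w i` in row `i`. -/
def rowBox (n : ℕ) (w : Fin n → ℝ) (r : ℝ) : Set (Fin n → Fin n → ℝ) :=
  Set.univ.pi fun i => Set.univ.pi fun j =>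
    Set.Ioo ((1 : Matrix (Fin n) (Fin n) ℝ) i j - r * w i)
      ((1 : Matrix (Fin n) (Fin n) ℝ) i j + r * w i)

theorem mem_rowBox {n : ℕ} {w : Fin n → ℝ} {r : ℝ} {g : Fin n → Fin n → ℝ} :
    g ∈ rowBox n w r ↔ ∀ i j, |g i j - (1 : Matrix (Fin n) (Fin n) ℝ) i j| < r * w i := by
  simp only [rowBox, Set.mem_univ_pi, Set.mem_Ioo, abs_sub_lt_iff]
  refine forall₂_congr fun i j => ?_
  constructor <;> rintro ⟨h₁, h₂⟩ <;> constructor <;> linarith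

theorem measurableSet_rowBox (n : ℕ) (w : Fin n → ℝ) (r : ℝ) :
    MeasurableSet (rowBox n w r) :=
  MeasurableSet.univ_pi fun _ => MeasurableSet.univ_pi fun _ => measurableSet_Ioo

theorem rowBox_mono {n : ℕ} {w : Fin n → ℝ} (hw : ∀ i, 0 ≤ w i) {r s : ℝ} (h : r ≤ s) :
    rowBox n w r ⊆ rowBox n w s := fun _ hg =>
  mem_rowBox.2 fun i j => (mem_rowBox.1 hg i j).trans_le (mul_le_mul_of_nonneg_right h (hw i))

theorem volume_rowBox (n : ℕ) {w : Fin n → ℝ} (hw : ∀ i, 0 ≤ w i) {r : ℝ} (hr : 0 ≤ r) :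
    volume (rowBox n w r) = ENNReal.ofReal (r ^ (n * n) * ∏ i, (2 * w i) ^ n) := by
  have h (i : Fin n) : 0 ≤ (r * (2 * w i)) ^ n := by
    have := hw i
    positivity
  have e (i j : Fin n) : (1 : Matrix (Fin n) (Fin n) ℝ) i j + r * w i -
      ((1 : Matrix (Fin n) (Fin n) ℝ) i j - r * w i) = r * (2 * w i) := by ring
  have e' (i : Fin n) : 0 ≤ r * (2 * w i) := by
    have := hw i
    positivity
  simp only [rowBox, volume_pi_pi, Real.volume_Ioo, e, Finset.prod_const, Finset.card_univ,
    Fintype.card_fin, ← ENNReal.ofReal_pow (e' _)]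
  rw [← ENNReal.ofReal_prod_of_nonneg fun i _ => h i]
  simp only [mul_pow r, Finset.prod_mul_distrib, Finset.prod_const, Finset.card_univ,
    Fintype.card_fin, ← pow_mul]

/-- A matrix entrywise within `r` of the identity is invertible when `r` times the size is less
than one half. -/
theorem det_ne_zero_of_abs_sub_one_le {ι : Type*} [Fintype ι] [DecidableEq ι]
    {M : Matrix ι ι ℝ} {r : ℝ} (hr : r * Fintype.card ι < 1 / 2)
    (hM : ∀ i j, |M i j - (1 : Matrix ι ι ℝ) i j| ≤ r) : M.det ≠ 0 := by
  refine det_ne_zero_of_sum_row_lt_diag fun k => ?_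
  have h0 : 0 ≤ r := (abs_nonneg _).trans (hM k k)
  have h1 : ∑ j ∈ Finset.univ.erase k, ‖M k j‖ ≤ r * (Fintype.card ι - 1) := by
    calc ∑ j ∈ Finset.univ.erase k, ‖M k j‖ ≤ ∑ j ∈ Finset.univ.erase k, r := by
          refine Finset.sum_le_sum fun j hj => ?_
          have := hM k j
          rwa [Matrix.one_apply_ne (Finset.ne_of_mem_erase hj).symm, sub_zero] at this
      _ = r * (Fintype.card ι - 1) := by
          rw [Finset.sum_const, Finset.card_erase_of_mem (Finset.mem_univ k), nsmul_eq_mul,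
            Finset.card_univ, Nat.cast_sub (Fintype.card_pos_iff.2 ⟨k⟩)]
          push_cast
          ring
  have h2 := hM k k
  rw [Matrix.one_apply_eq] at h2
  have h3 := (abs_le.1 h2).1
  have h4 := le_abs_self (M k k)
  rw [Real.norm_eq_abs (M k k)]
  linarith

/-- The row weights of `K1`: one, except for `1 / X` in the last row. -/
def rowWeight (n : ℕ) (X : ℝ) (i : Fin n) : ℝ := if i.val < n - 1 then 1 else 1 / X

theorem rowWeight_pos (n : ℕ) {X : ℝ} (hX : 1 ≤ X) (i : Fin n) : 0 < rowWeight n X i := by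
  unfold rowWeight
  split_ifs <;> positivity

theorem rowWeight_le_one (n : ℕ) {X : ℝ} (hX : 1 ≤ X) (i : Fin n) : rowWeight n X i ≤ 1 := by
  unfold rowWeight
  split_ifs
  · exact le_rfl
  · exact div_le_one_of_le₀ hX (by positivity)

theorem K1_subset_rowBox (n : ℕ) (X τ : ℝ) : K1 n X τ ⊆ rowBox n (rowWeight n X) τ := by
  rintro g ⟨-, -, ha, hb, hc, hd⟩
  refine mem_rowBox.2 fun i j => ?_
  have hi := i.isLt
  have hj := j.isLt
  rw [Matrix.one_apply]
  unfold rowWeight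
  rcases lt_or_ge i.val (n - 1) with hi' | hi' <;> rcases lt_or_ge j.val (n - 1) with hj' | hj'
  · rw [if_pos hi', mul_one]
    exact ha i j hi' hj'
  · rw [if_pos hi', mul_one, if_neg (by rintro rfl; omega), sub_zero]
    exact hb i j hi' (by omega)
  · rw [if_neg hi'.not_gt, mul_one_div, if_neg (by rintro rfl; omega), sub_zero]
    exact hc i j (by omega) hj'
  · rw [if_neg hi'.not_gt, mul_one_div, if_pos (Fin.ext (by omega))]
    exact hd i j (by omega) (by omega)

theorem abs_sub_one_le_of_mem_rowBox {n : ℕ} {w : Fin n → ℝ} (hw : ∀ i, w i ≤ 1) {r : ℝ}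
    (hr : 0 ≤ r) {g : Fin n → Fin n → ℝ} (hg : g ∈ rowBox n w r) (i j : Fin n) :
    |g i j - (1 : Matrix (Fin n) (Fin n) ℝ) i j| ≤ r :=
  (mem_rowBox.1 hg i j).le.trans (mul_le_of_le_one_right hr (hw i))

theorem rowBox_subset_K1 {n : ℕ} {X τ : ℝ} (hX : 1 ≤ X) (hτ : 0 ≤ τ) (hn : τ * n < 1 / 2) :
    rowBox n (rowWeight n X) τ ⊆ K1 n X τ := by
  intro g hg
  have hle := abs_sub_one_le_of_mem_rowBox (rowWeight_le_one n hX) hτ hg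
  have hlt := mem_rowBox.1 hg
  refine ⟨?_, ?_, ?_, ?_, ?_, ?_⟩
  · exact (det_ne_zero_of_abs_sub_one_le (by simpa using hn) hle).isUnit
  · refine (det_ne_zero_of_abs_sub_one_le (r := τ) ?_ fun i j => ?_).isUnit
    · rw [Fintype.card_fin]
      exact (mul_le_mul_of_nonneg_left (by exact_mod_cast Nat.sub_le n 1) hτ).trans_lt hn
    · have := hle (Fin.castLE (Nat.sub_le n 1) i) (Fin.castLE (Nat.sub_le n 1) j)
      simpa [Matrix.one_apply] using this
  · intro i j hi hj
    have := hlt i j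
    rwa [rowWeight, if_pos hi, mul_one, Matrix.one_apply] at this
  · intro i j hi hj
    have := hlt i j
    rwa [rowWeight, if_pos hi, mul_one, Matrix.one_apply, if_neg (by rintro rfl; omega),
      sub_zero] at this
  · intro i j hi hj
    have := hlt i j
    rwa [rowWeight, if_neg (by omega), mul_one_div, Matrix.one_apply,
      if_neg (by rintro rfl; omega), sub_zero] at this
  · intro i j hi hj
    have := hlt i j
    rwa [rowWeight, if_neg (by omega), mul_one_div, Matrix.one_apply,
      if_pos (Fin.ext (by omega))] at this

theorem mulG_eq_add (n : ℕ) (g h : Fin n → Fin n → ℝ) (i j : Fin n) :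
    mulG n g h i j =
      ∑ k, (g i k - (1 : Matrix (Fin n) (Fin n) ℝ) i k) * h k j + h i j := by
  simp [mulG, sub_mul, Finset.sum_sub_distrib, Matrix.one_apply]

theorem abs_sum_sub_one_mul_le {n : ℕ} {w : Fin n → ℝ} {τ M : ℝ}
    {g h : Fin n → Fin n → ℝ} (hg : g ∈ rowBox n w τ) {j : Fin n} (hh : ∀ k, |h k j| ≤ M)
    (i : Fin n) :
    |∑ k, (g i k - (1 : Matrix (Fin n) (Fin n) ℝ) i k) * h k j| ≤ n * τ * M * w i := by
  have hw : 0 ≤ τ * w i := (abs_nonneg _).trans (mem_rowBox.1 hg i i).le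
  calc _ ≤ ∑ k, |(g i k - (1 : Matrix (Fin n) (Fin n) ℝ) i k) * h k j| :=
        Finset.abs_sum_le_sum_abs _ _
    _ ≤ ∑ _k : Fin n, τ * w i * M := Finset.sum_le_sum fun k _ => by
        rw [abs_mul]
        exact mul_le_mul (mem_rowBox.1 hg i k).le (hh k) (abs_nonneg _) hw
    _ = n * τ * M * w i := by simp; ring

theorem abs_le_two_of_mem_rowBox {n : ℕ} {w : Fin n → ℝ} (hw : ∀ i, w i ≤ 1) {r : ℝ}
    (hr : 0 ≤ r) (hr1 : r ≤ 1) {g : Fin n → Fin n → ℝ} (hg : g ∈ rowBox n w r) (i j : Fin n) :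
    |g i j| ≤ 2 := by
  have h1 := abs_sub_one_le_of_mem_rowBox hw hr hg i j
  have h2 : |(1 : Matrix (Fin n) (Fin n) ℝ) i j| ≤ 1 := by
    rw [Matrix.one_apply]
    split_ifs <;> simp
  have h3 := abs_sub_abs_le_abs_sub (g i j) ((1 : Matrix (Fin n) (Fin n) ℝ) i j)
  linarith

theorem mulG_mem_rowBox {n : ℕ} {w : Fin n → ℝ} (hw : ∀ i, w i ≤ 1) (hw0 : ∀ i, 0 ≤ w i)
    {τ r ε : ℝ} (hτ : 4 * n * τ ≤ ε) (hτ0 : 0 ≤ τ) (hr : 0 ≤ r) (hr1 : r ≤ 1)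
    {g h : Fin n → Fin n → ℝ} (hg : g ∈ rowBox n w τ) (hh : h ∈ rowBox n w r) :
    mulG n g h ∈ rowBox n w (r + ε) := by
  refine mem_rowBox.2 fun i j => ?_
  have h1 := abs_sum_sub_one_mul_le hg (j := j)
    (fun k => abs_le_two_of_mem_rowBox hw hr hr1 hh k j) i
  have h2 := mem_rowBox.1 hh i j
  rw [mulG_eq_add, add_sub_assoc]
  have h3 : n * τ * 2 * w i ≤ ε * w i :=
    mul_le_mul_of_nonneg_right (by nlinarith [mul_nonneg n.cast_nonneg hτ0]) (hw0 i)
  calc _ ≤ _ := abs_add_le _ _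
    _ < (r + ε) * w i := by linarith

theorem mem_rowBox_of_mulG_mem {n : ℕ} {w : Fin n → ℝ} (hw : ∀ i, w i ≤ 1)
    (hw0 : ∀ i, 0 ≤ w i) {τ r ε : ℝ} (hτ : 4 * n * τ ≤ ε) (hτ0 : 0 ≤ τ) (hnτ : τ * n < 1 / 2)
    (hr : 0 ≤ r) (hr1 : r ≤ 1) {g x : Fin n → Fin n → ℝ} (hg : g ∈ rowBox n w τ)
    (hx : mulG n g x ∈ rowBox n w r) : x ∈ rowBox n w (r + ε) := by
  have bound (j : Fin n) : ∀ k, |x k j| ≤ 4 := by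
    have : Nonempty (Fin n) := ⟨j⟩
    obtain ⟨m, hm⟩ := Finite.exists_max fun k => |x k j|
    have h1 := abs_sum_sub_one_mul_le hg hm m
    have h2 := abs_le_two_of_mem_rowBox hw hr hr1 hx m j
    rw [mulG_eq_add] at h2
    have h3 : n * τ * |x m j| * w m ≤ 1 / 2 * |x m j| :=
      (mul_le_of_le_one_right (by positivity) (hw m)).trans
        (mul_le_mul_of_nonneg_right (by linarith) (abs_nonneg _))
    set S := ∑ k, (g m k - (1 : Matrix (Fin n) (Fin n) ℝ) m k) * x k j
    have h4 := abs_sub_abs_le_abs_sub (x m j) (-S)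
    rw [abs_neg, sub_neg_eq_add, add_comm (x m j) S] at h4
    intro k
    have := hm k
    linarith
  refine mem_rowBox.2 fun i j => ?_
  have h1 := abs_sum_sub_one_mul_le hg (bound j) i
  have h2 := mem_rowBox.1 hx i j
  rw [mulG_eq_add] at h2
  have h3 : n * τ * 4 * w i ≤ ε * w i :=
    mul_le_mul_of_nonneg_right (by linarith) (hw0 i)
  set S := ∑ k, (g i k - (1 : Matrix (Fin n) (Fin n) ℝ) i k) * x k j
  calc |x i j - (1 : Matrix (Fin n) (Fin n) ℝ) i j|
      = |(S + x i j - (1 : Matrix (Fin n) (Fin n) ℝ) i j) - S| := by ring_nf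
    _ ≤ _ := abs_sub _ _
    _ < (r + ε) * w i := by linarith

theorem exists_mulG_eq {n : ℕ} {g : Fin n → Fin n → ℝ} (hg : IsUnit (Matrix.of g).det)
    (h : Fin n → Fin n → ℝ) : ∃ x, mulG n g x = h := by
  refine ⟨(Matrix.of g)⁻¹ * Matrix.of h, ?_⟩
  have : Matrix.of g * ((Matrix.of g)⁻¹ * Matrix.of h) = Matrix.of h :=
    Matrix.mul_nonsing_inv_cancel_left _ _ hg
  ext i j
  exact congrFun (congrFun this i) j

theorem symmDiff_image_K1_subset {n : ℕ} {X τ τ₀ ε : ℝ} (hX : 1 ≤ X) (hε : 4 * n * τ ≤ ε)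
    (hτ : 0 ≤ τ) (hnτ : τ * n < 1 / 2) (hε0 : 0 ≤ ε) (hετ : ε ≤ τ₀) (hn₀ : τ₀ * n < 1 / 2)
    (h1 : τ₀ ≤ 1) {g : Fin n → Fin n → ℝ} (hg : g ∈ K1 n X τ) :
    symmDiff (mulG n g '' K1 n X τ₀) (K1 n X τ₀) ⊆
      rowBox n (rowWeight n X) (τ₀ + ε) \ rowBox n (rowWeight n X) (τ₀ - ε) := by
  have hw := rowWeight_le_one n hX
  have hw0 i := (rowWeight_pos n hX i).le
  have hg' := K1_subset_rowBox n X τ hg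
  have hA : K1 n X τ₀ = rowBox n (rowWeight n X) τ₀ :=
    (K1_subset_rowBox n X τ₀).antisymm (rowBox_subset_K1 hX (hε0.trans hετ) hn₀)
  rw [hA]
  rintro y (⟨⟨x, hx, rfl⟩, hy⟩ | ⟨hy, hy'⟩)
  · exact ⟨mulG_mem_rowBox hw hw0 hε hτ (hε0.trans hετ) h1 hg' hx,
      fun h => hy (rowBox_mono hw0 (by linarith) h)⟩
  · refine ⟨rowBox_mono hw0 (by linarith) hy, fun h => hy' ?_⟩
    obtain ⟨x, rfl⟩ := exists_mulG_eq hg.1 y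
    refine ⟨x, ?_, rfl⟩
    have := mem_rowBox_of_mulG_mem hw hw0 hε hτ hnτ (by linarith) (by linarith) hg' h
    rwa [sub_add_cancel] at this

/-- The density of `muGL` is bounded above and below near the identity. -/
theorem exists_density_bounds (n : ℕ) {r : ℝ} (hr : r * n < 1 / 2) :
    ∃ c C : ℝ, 0 < c ∧ 0 < C ∧ ∀ g : Fin n → Fin n → ℝ,
      (∀ i j, |g i j - (1 : Matrix (Fin n) (Fin n) ℝ) i j| ≤ r) →
        c ≤ 1 / |(Matrix.of g).det| ^ n ∧ 1 / |(Matrix.of g).det| ^ n ≤ C := by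
  set K : Set (Fin n → Fin n → ℝ) := Set.univ.pi fun i => Set.univ.pi fun j =>
    Set.Icc ((1 : Matrix (Fin n) (Fin n) ℝ) i j - r) ((1 : Matrix (Fin n) (Fin n) ℝ) i j + r)
  have hK : IsCompact K :=
    isCompact_univ_pi fun _ => isCompact_univ_pi fun _ => isCompact_Icc
  have memK {g : Fin n → Fin n → ℝ} :
      g ∈ K ↔ ∀ i j, |g i j - (1 : Matrix (Fin n) (Fin n) ℝ) i j| ≤ r := by
    simp only [K, Set.mem_univ_pi, Set.mem_Icc, abs_sub_le_iff]
    refine forall₂_congr fun i j => ?_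
    constructor <;> rintro ⟨h₁, h₂⟩ <;> constructor <;> linarith
  have hdet : ∀ g ∈ K, 0 < |(Matrix.of g).det| ^ n := fun g hg =>
    pow_pos (abs_pos.2 (det_ne_zero_of_abs_sub_one_le (by simpa using hr) (memK.1 hg))) n
  have hcont : ContinuousOn (fun g : Fin n → Fin n → ℝ => |(Matrix.of g).det| ^ n) K :=
    (((Continuous.matrix_det (A := fun g : Fin n → Fin n → ℝ => Matrix.of g)
      continuous_id).abs).pow n).continuousOn
  obtain ⟨c, hc, hcK⟩ := hK.exists_forall_le' hcont hdet
  obtain ⟨C, hC⟩ := hK.bddAbove_image hcont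
  refine ⟨1 / max C 1, 1 / c, by positivity, by positivity, fun g hg => ?_⟩
  have hg' := memK.2 hg
  exact ⟨one_div_le_one_div_of_le (hdet g hg')
    ((hC (Set.mem_image_of_mem _ hg')).trans (le_max_left _ _)),
    one_div_le_one_div_of_le hc (hcK g hg')⟩

theorem muGL_le {n : ℕ} {C : ℝ} {S : Set (Fin n → Fin n → ℝ)} (hS : MeasurableSet S)
    (hC : ∀ g ∈ S, 1 / |(Matrix.of g).det| ^ n ≤ C) :
    muGL n S ≤ ENNReal.ofReal C * volume S := by
  rw [muGL, withDensity_apply _ hS, ← setLIntegral_const]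
  exact setLIntegral_mono' hS fun g hg => ENNReal.ofReal_le_ofReal (hC g hg)

theorem le_muGL {n : ℕ} {c : ℝ} {S : Set (Fin n → Fin n → ℝ)} (hS : MeasurableSet S)
    (hc : ∀ g ∈ S, c ≤ 1 / |(Matrix.of g).det| ^ n) :
    ENNReal.ofReal c * volume S ≤ muGL n S := by
  rw [muGL, withDensity_apply _ hS, ← setLIntegral_const]
  exact setLIntegral_mono' hS fun g hg => ENNReal.ofReal_le_ofReal (hc g hg)

open Filter Topology in
theorem exists_small_pow_sub_pow_lt (N : ℕ) {C t a b : ℝ} (ha : 0 < a) (hb : 0 < b) :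
    ∃ ε, 0 < ε ∧ ε < a ∧ C * ((t + ε) ^ N - (t - ε) ^ N) < b := by
  have h : Tendsto (fun ε : ℝ => C * ((t + ε) ^ N - (t - ε) ^ N)) (𝓝[>] 0) (𝓝 0) := by
    have : Continuous fun ε : ℝ => C * ((t + ε) ^ N - (t - ε) ^ N) := by fun_prop
    simpa using (this.tendsto 0).mono_left nhdsWithin_le_nhds
  obtain ⟨ε, h1, h2⟩ := ((h.eventually_lt_const hb).and (Ioo_mem_nhdsGT ha)).exists
  exact ⟨ε, h2.1, h2.2, h1⟩

/-- Følner-type property of the congruence subsets `K₁(X,τ)` (Lemma 1.2, case `* = 1`):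
for all `τ₀ ∈ (0, 1/(2n))` and `δ ∈ (0,1)` there is `τ₁ ∈ (0,τ₀)` so that for all
`X ≥ 1` and `g ∈ K₁(X,τ₁)`, the set `A = K₁(X,τ₀)` satisfies
`μ(gA △ A) < δ · μ(A)`. -/
theorem folner_K1 (n : ℕ) (hn : 2 ≤ n) (τ₀ δ : ℝ)
    (hτ₀ : 0 < τ₀) (hτ₀' : τ₀ < 1 / (2 * (n : ℝ))) (hδ : 0 < δ) (hδ' : δ < 1) :
    ∃ τ₁ : ℝ, 0 < τ₁ ∧ τ₁ < τ₀ ∧ ∀ X : ℝ, 1 ≤ X → ∀ g ∈ K1 n X τ₁,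
      muGL n (symmDiff ((mulG n g) '' K1 n X τ₀) (K1 n X τ₀)) <
        ENNReal.ofReal δ * muGL n (K1 n X τ₀) := by
  have hn0 : (0 : ℝ) < n := by positivity
  have hn2 : (2 : ℝ) ≤ n := by exact_mod_cast hn
  have hn₀ : τ₀ * n < 1 / 2 := by
    rw [lt_div_iff₀ (by positivity)] at hτ₀'
    linarith
  have hτ1 : τ₀ ≤ 1 := by nlinarith
  obtain ⟨r, hr, hr'⟩ := exists_between hτ₀'
  have hnr : r * n < 1 / 2 := by
    rw [lt_div_iff₀ (by positivity)] at hr'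
    linarith
  obtain ⟨c, C, hc, hC, hcC⟩ := exists_density_bounds n hnr
  obtain ⟨ε, hε, hεa, hεb⟩ := exists_small_pow_sub_pow_lt (n * n) (C := C) (t := τ₀)
    (a := min τ₀ (r - τ₀)) (b := δ * (c * τ₀ ^ (n * n)))
    (lt_min hτ₀ (sub_pos.2 hr)) (by positivity)
  have hετ := hεa.trans_le (min_le_left _ _)
  have hεr := hεa.trans_le (min_le_right _ _)
  have hlt : ε / (4 * n) < τ₀ := (div_le_self hε.le (by linarith)).trans_lt hετ
  refine ⟨ε / (4 * n), by positivity, hlt, fun X hX g hg => ?_⟩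
  set w := rowWeight n X
  have hw0 i : 0 ≤ w i := (rowWeight_pos n hX i).le
  have hsub := symmDiff_image_K1_subset hX (mul_div_cancel₀ ε (by positivity)).le
    (by positivity) ((mul_lt_mul_of_pos_right hlt hn0).trans hn₀) hε.le hετ.le hn₀ hτ1 hg
  have hbound {s : ℝ} (hs : 0 ≤ s) (hsr : s ≤ r) (y) (hy : y ∈ rowBox n w s) := hcC y fun i j =>
    (abs_sub_one_le_of_mem_rowBox (rowWeight_le_one n hX) hs hy i j).trans hsr
  set W := ∏ i, (2 * w i) ^ n
  have hW : 0 < W := Finset.prod_pos fun i _ => by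
    have := rowWeight_pos n hX i
    positivity
  have hvol : volume (rowBox n w (τ₀ + ε) \ rowBox n w (τ₀ - ε)) =
      ENNReal.ofReal (((τ₀ + ε) ^ (n * n) - (τ₀ - ε) ^ (n * n)) * W) := by
    rw [measure_sdiff (rowBox_mono hw0 (by linarith))
      (measurableSet_rowBox n w _).nullMeasurableSet
      (by rw [volume_rowBox n hw0 (by linarith)]; exact ENNReal.ofReal_ne_top),
      volume_rowBox n hw0 (by linarith), volume_rowBox n hw0 (by linarith),
      ← ENNReal.ofReal_sub _ (mul_nonneg (pow_nonneg (by linarith) _) hW.le), sub_mul]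
  calc muGL n (symmDiff (mulG n g '' K1 n X τ₀) (K1 n X τ₀))
      ≤ muGL n (rowBox n w (τ₀ + ε) \ rowBox n w (τ₀ - ε)) := measure_mono hsub
    _ ≤ ENNReal.ofReal C * volume (rowBox n w (τ₀ + ε) \ rowBox n w (τ₀ - ε)) :=
        muGL_le ((measurableSet_rowBox n w _).diff (measurableSet_rowBox n w _)) fun y hy =>
          (hbound (by linarith) (by linarith) y hy.1).2
    _ = ENNReal.ofReal (C * ((τ₀ + ε) ^ (n * n) - (τ₀ - ε) ^ (n * n)) * W) := by
        rw [hvol, ← ENNReal.ofReal_mul hC.le, mul_assoc]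
    _ < ENNReal.ofReal (δ * (c * τ₀ ^ (n * n)) * W) :=
        (ENNReal.ofReal_lt_ofReal_iff (by positivity)).2 (mul_lt_mul_of_pos_right hεb hW)
    _ = ENNReal.ofReal δ * (ENNReal.ofReal c * volume (rowBox n w τ₀)) := by
        rw [volume_rowBox n hw0 hτ₀.le, ← ENNReal.ofReal_mul hc.le, ← ENNReal.ofReal_mul hδ.le,
          mul_assoc, mul_assoc]
    _ ≤ ENNReal.ofReal δ * muGL n (rowBox n w τ₀) := by
        gcongr
        exact le_muGL (measurableSet_rowBox n w _) fun y hy => (hbound hτ₀.le hr.le y hy).1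
    _ ≤ ENNReal.ofReal δ * muGL n (K1 n X τ₀) := by
        gcongr
        exact rowBox_subset_K1 hX hτ₀.le hn₀
end
end

section
/- Fix an integer n ≥ 2, τ₀ ∈ (0, 1/(2n)) and δ > 0. Then there exists ν ∈ (τ₀, 1/(2n)) such that for all real X ≥ 1, μ(K₀(X,ν)) − μ(K₀(X,τ₀)) < δ·μ(K₀(X,τ₀)). -/
open MeasureTheory

noncomputable section

open Filter Topology

/-- The dilation `h ↦ 1 + τ h` on the space of `n × n` matrices. -/
def oneAddSMul (n : ℕ) (τ : ℝ) (h : Fin n → Fin n → ℝ) : Fin n → Fin n → ℝ :=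
  fun i j => (if i = j then 1 else 0) + τ * h i j

/-- The entrywise radii of the rescaled box: `1/X` in the bottom-left block, `1` elsewhere. -/
def boxRadius (n : ℕ) (X : ℝ) (i j : Fin n) : ℝ :=
  if i.val = n - 1 ∧ j.val < n - 1 then 1 / X else 1

/-- The box of matrices whose entries are smaller than `boxRadius`. -/
def openBox (n : ℕ) (X : ℝ) : Set (Fin n → Fin n → ℝ) :=
  {h | ∀ i j, |h i j| < boxRadius n X i j}

/-- The closed unit cube of `n × n` matrices. -/
def closedCube (n : ℕ) : Set (Fin n → Fin n → ℝ) :=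
  Set.univ.pi fun _ => Set.univ.pi fun _ => Set.Icc (-1) 1

lemma mem_closedCube {n : ℕ} {h : Fin n → Fin n → ℝ} :
    h ∈ closedCube n ↔ ∀ i j, |h i j| ≤ 1 := by
  simp only [closedCube, Set.mem_pi, Set.mem_univ, true_imp_iff, Set.mem_Icc, abs_le]

lemma isCompact_closedCube (n : ℕ) : IsCompact (closedCube n) :=
  isCompact_univ_pi fun _ => isCompact_univ_pi fun _ => isCompact_Icc

lemma boxRadius_pos (n : ℕ) {X : ℝ} (hX : 1 ≤ X) (i j : Fin n) : 0 < boxRadius n X i j := by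
  unfold boxRadius
  split_ifs <;> positivity

lemma openBox_subset_closedCube (n : ℕ) {X : ℝ} (hX : 1 ≤ X) : openBox n X ⊆ closedCube n := by
  intro h hh
  refine mem_closedCube.2 fun i j => (hh i j).le.trans ?_
  unfold boxRadius
  split_ifs
  · rw [div_le_one (by linarith)]
    exact hX
  · exact le_rfl

lemma isOpen_openBox (n : ℕ) (X : ℝ) : IsOpen (openBox n X) := by
  simp only [openBox, Set.ofPred_forall]
  exact isOpen_iInter_of_finite fun i => isOpen_iInter_of_finite fun j =>
    isOpen_lt (by fun_prop) continuous_const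

lemma det_one_add_ne_zero {m : ℕ} {τ : ℝ} (h0 : 0 < τ) (hτ : τ * (2 * m) < 1)
    (h : Fin m → Fin m → ℝ) (hh : ∀ i j, |h i j| ≤ 1) :
    (Matrix.of (oneAddSMul m τ h)).det ≠ 0 := by
  refine det_ne_zero_of_sum_row_lt_diag fun k => ?_
  have hentry : ∀ i j, |τ * h i j| ≤ τ := fun i j => by
    rw [abs_mul, abs_of_pos h0]
    exact mul_le_of_le_one_right h0.le (hh i j)
  have hsum : ∑ j ∈ Finset.univ.erase k, ‖Matrix.of (oneAddSMul m τ h) k j‖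
      ≤ ∑ j ∈ Finset.univ.erase k, τ := by
    refine Finset.sum_le_sum fun j hj => ?_
    have hkj : k ≠ j := (Finset.ne_of_mem_erase hj).symm
    simpa [oneAddSMul, hkj] using hentry k j
  have hm : 1 ≤ m := k.pos
  rw [Finset.sum_const, Finset.card_erase_of_mem (Finset.mem_univ k), Finset.card_univ,
    Fintype.card_fin, nsmul_eq_mul, Nat.cast_sub hm] at hsum
  have hm' : (1 : ℝ) ≤ m := by exact_mod_cast hm
  have hdiag : 1 - τ ≤ ‖Matrix.of (oneAddSMul m τ h) k k‖ := by
    have := (abs_le.1 (hentry k k)).1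
    simp only [Matrix.of_apply, oneAddSMul, if_true, Real.norm_eq_abs]
    exact le_trans (by linarith) (le_abs_self _)
  push_cast at hsum
  nlinarith

lemma continuous_oneAddSMul (n : ℕ) (τ : ℝ) : Continuous (oneAddSMul n τ) := by
  unfold oneAddSMul
  fun_prop

lemma oneAddSMul_preimage_K0 {n : ℕ} {τ X : ℝ} (h0 : 0 < τ) (hτ : τ * (2 * n) < 1)
    (hX : 1 ≤ X) : oneAddSMul n τ ⁻¹' K0 n X τ = openBox n X := by
  have hX0 : 0 < X := by linarith
  have habs : ∀ x : ℝ, |τ * x| < τ ↔ |x| < 1 := fun x => by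
    rw [abs_mul, abs_of_pos h0]
    exact mul_lt_iff_lt_one_right h0
  have habs' : ∀ x : ℝ, |τ * x| < τ / X ↔ |x| < 1 / X := fun x => by
    rw [abs_mul, abs_of_pos h0, div_eq_mul_one_div τ X]
    exact mul_lt_mul_iff_right₀ h0
  ext h
  constructor
  · rintro ⟨-, -, ha, hb, hc, hd⟩ i j
    unfold boxRadius
    have hi := i.isLt
    have hj := j.isLt
    rcases (show i.val < n - 1 ∨ i.val = n - 1 by omega) with hi' | hi' <;>
      rcases (show j.val < n - 1 ∨ j.val = n - 1 by omega) with hj' | hj'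
    · rw [if_neg (by omega), ← habs]
      simpa [oneAddSMul] using ha i j hi' hj'
    · have hij : i ≠ j := fun e => by subst e; omega
      rw [if_neg (by omega), ← habs]
      simpa [oneAddSMul, hij] using hb i j hi' hj'
    · have hij : i ≠ j := fun e => by subst e; omega
      rw [if_pos ⟨hi', hj'⟩, ← habs']
      simpa [oneAddSMul, hij] using hc i j hi' hj'
    · have hij : i = j := Fin.ext (by omega)
      rw [if_neg (by omega), ← habs]
      simpa [oneAddSMul, hij] using hd i j hi' hj'
  · intro hh
    have hle := mem_closedCube.1 (openBox_subset_closedCube n hX hh)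
    refine ⟨(det_one_add_ne_zero h0 hτ h hle).isUnit, ?_, fun i j hi hj => ?_,
      fun i j hi hj => ?_, fun i j hi hj => ?_, fun i j hi hj => ?_⟩
    · have hcast : ((n - 1 : ℕ) : ℝ) ≤ n := by exact_mod_cast Nat.sub_le n 1
      have := det_one_add_ne_zero (m := n - 1) h0 (by nlinarith)
        (fun i j => h (Fin.castLE (Nat.sub_le n 1) i) (Fin.castLE (Nat.sub_le n 1) j))
        (fun i j => hle _ _)
      have hblock : oneAddSMul (n - 1) τ
          (fun i j => h (Fin.castLE (Nat.sub_le n 1) i) (Fin.castLE (Nat.sub_le n 1) j)) =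
          fun i j => oneAddSMul n τ h (Fin.castLE (Nat.sub_le n 1) i)
            (Fin.castLE (Nat.sub_le n 1) j) := by
        ext i j
        simp [oneAddSMul, Fin.castLE_inj]
      rw [hblock] at this
      exact this.isUnit
    · have := hh i j
      rw [boxRadius, if_neg (by omega), ← habs] at this
      simpa [oneAddSMul] using this
    · have hij : i ≠ j := fun e => by subst e; omega
      have := hh i j
      rw [boxRadius, if_neg (by omega), ← habs] at this
      simpa [oneAddSMul, hij] using this
    · have hij : i ≠ j := fun e => by subst e; omega
      have := hh i j
      rw [boxRadius, if_pos ⟨hi, hj⟩, ← habs'] at this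
      simpa [oneAddSMul, hij] using this
    · have hij : i = j := Fin.ext (by omega)
      have := hh i j
      rw [boxRadius, if_neg (by omega), ← habs] at this
      simpa [oneAddSMul, hij] using this

lemma map_oneAddSMul_volume (n : ℕ) {τ : ℝ} (h0 : 0 < τ) :
    (volume : Measure (Fin n → Fin n → ℝ)) =
      ENNReal.ofReal (τ ^ Module.finrank ℝ (Fin n → Fin n → ℝ)) •
        Measure.map (oneAddSMul n τ) volume := by
  have hcomp : oneAddSMul n τ =
      (fun g => (fun i j => if i = j then (1 : ℝ) else 0) + g) ∘ (fun h => τ • h) := by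
    ext h i j
    simp [oneAddSMul]
  rw [hcomp, ← Measure.map_map (by fun_prop) (by fun_prop),
    Measure.map_addHaar_smul _ h0.ne', Measure.map_smul, map_add_left_eq_self, smul_smul,
    abs_of_pos (by positivity), ← ENNReal.ofReal_mul (by positivity),
    mul_inv_cancel₀ (by positivity), ENNReal.ofReal_one, one_smul]

/-- The density of the Haar measure pulled back along `oneAddSMul`. -/
def pulledDensity (n : ℕ) (τ : ℝ) (h : Fin n → Fin n → ℝ) : ℝ :=
  τ ^ Module.finrank ℝ (Fin n → Fin n → ℝ) *
    (1 / |(Matrix.of (oneAddSMul n τ h)).det| ^ n)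

lemma muGL_K0_eq_lintegral {n : ℕ} {τ X : ℝ} (h0 : 0 < τ) (hτ : τ * (2 * n) < 1)
    (hX : 1 ≤ X) :
    muGL n (K0 n X τ) = ∫⁻ h in openBox n X, ENNReal.ofReal (pulledDensity n τ h) := by
  have hemb : MeasurableEmbedding (oneAddSMul n τ) := by
    refine (continuous_oneAddSMul n τ).measurableEmbedding fun g h hgh => ?_
    ext i j
    have := congrFun (congrFun hgh i) j
    simpa [oneAddSMul, h0.ne'] using this
  conv_lhs => rw [muGL, withDensity_apply', map_oneAddSMul_volume n h0, Measure.restrict_smul,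
    lintegral_smul_measure, hemb.restrict_map, hemb.lintegral_map,
    oneAddSMul_preimage_K0 h0 hτ hX, smul_eq_mul,
    ← lintegral_const_mul' _ _ ENNReal.ofReal_ne_top]
  refine lintegral_congr fun h => ?_
  rw [pulledDensity, ENNReal.ofReal_mul (by positivity)]

lemma continuousAt_pulledDensity {n : ℕ} {τ : ℝ} (h0 : 0 < τ) (hτ : τ * (2 * n) < 1)
    {h : Fin n → Fin n → ℝ} (hh : h ∈ closedCube n) :
    ContinuousAt (fun p : ℝ × (Fin n → Fin n → ℝ) => pulledDensity n p.1 p.2) (τ, h) := by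
  have hdet := det_one_add_ne_zero h0 hτ h (mem_closedCube.1 hh)
  have hcont : Continuous fun p : ℝ × (Fin n → Fin n → ℝ) =>
      (Matrix.of (oneAddSMul n p.1 p.2)).det := by
    refine Continuous.matrix_det (continuous_matrix fun i j => ?_)
    simp only [Matrix.of_apply, oneAddSMul]
    fun_prop
  unfold pulledDensity
  refine ContinuousAt.mul (by fun_prop) (ContinuousAt.div continuousAt_const ?_ ?_)
  · exact (hcont.abs.pow n).continuousAt
  · exact pow_ne_zero _ (abs_ne_zero.2 hdet)

lemma pulledDensity_pos {n : ℕ} {τ : ℝ} (h0 : 0 < τ) (hτ : τ * (2 * n) < 1)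
    {h : Fin n → Fin n → ℝ} (hh : h ∈ closedCube n) : 0 < pulledDensity n τ h := by
  have := abs_pos.2 (det_one_add_ne_zero h0 hτ h (mem_closedCube.1 hh))
  unfold pulledDensity
  positivity

lemma eventually_pulledDensity_le {n : ℕ} {τ ε : ℝ} (h0 : 0 < τ) (hτ : τ * (2 * n) < 1)
    (hε : 0 < ε) :
    ∀ᶠ ν in 𝓝 τ, ∀ h ∈ closedCube n,
      pulledDensity n ν h < (1 + ε) * pulledDensity n τ h := by
  refine (isCompact_closedCube n).eventually_forall_of_forall_eventually fun h hh => ?_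
  have hpos := pulledDensity_pos h0 hτ hh
  have hcont := continuousAt_pulledDensity h0 hτ hh
  have hsnd : ContinuousAt (fun p : ℝ × (Fin n → Fin n → ℝ) => (τ, p.2)) (τ, h) := by
    fun_prop
  have hcont' : ContinuousAt (fun p : ℝ × (Fin n → Fin n → ℝ) =>
      (1 + ε) * pulledDensity n τ p.2) (τ, h) :=
    continuousAt_const.mul (ContinuousAt.comp (x := (τ, h))
      (g := fun p : ℝ × (Fin n → Fin n → ℝ) => pulledDensity n p.1 p.2) hcont hsnd)
  exact hcont.eventually_lt hcont' (by dsimp only; nlinarith)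

lemma muGL_K0_lt_top {n : ℕ} {τ X : ℝ} (h0 : 0 < τ) (hτ : τ * (2 * n) < 1)
    (hX : 1 ≤ X) : muGL n (K0 n X τ) < ⊤ := by
  rw [muGL_K0_eq_lintegral h0 hτ hX]
  have hcont : ContinuousOn (pulledDensity n τ) (closedCube n) := fun h hh =>
    (ContinuousAt.comp (f := fun h : Fin n → Fin n → ℝ => (τ, h))
      (continuousAt_pulledDensity h0 hτ hh) (by fun_prop)).continuousWithinAt
  exact ((hcont.integrableOn_compact (isCompact_closedCube n)).mono_set
    (openBox_subset_closedCube n hX)).lintegral_lt_top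

lemma muGL_K0_pos {n : ℕ} {τ X : ℝ} (h0 : 0 < τ) (hτ : τ * (2 * n) < 1)
    (hX : 1 ≤ X) : 0 < muGL n (K0 n X τ) := by
  rw [muGL_K0_eq_lintegral h0 hτ hX]
  have hmeas : Measurable fun h => ENNReal.ofReal (pulledDensity n τ h) := by
    have hdet : Continuous fun h : Fin n → Fin n → ℝ =>
        (Matrix.of (oneAddSMul n τ h)).det :=
      Continuous.matrix_det (continuous_oneAddSMul n τ)
    have := hdet.measurable
    unfold pulledDensity
    fun_prop
  rw [setLIntegral_pos_iff hmeas]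
  refine lt_of_lt_of_le ((isOpen_openBox n X).measure_pos volume
    ⟨0, fun i j => by simpa using boxRadius_pos n hX i j⟩)
    (measure_mono fun h hh => ⟨?_, hh⟩)
  exact (ENNReal.ofReal_pos.2
    (pulledDensity_pos h0 hτ (openBox_subset_closedCube n hX hh))).ne'

/-- Uniform-in-`X` continuity of `vol(K₀(X,τ))` in `τ` (from the proof of Lemma 1.2):
for `τ₀ ∈ (0, 1/(2n))` and `δ > 0` there is `ν ∈ (τ₀, 1/(2n))` such that for all `X ≥ 1`,
`μ(K₀(X,ν)) − μ(K₀(X,τ₀)) < δ·μ(K₀(X,τ₀))`. -/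
theorem vol_K0_continuity (n : ℕ) (hn : 2 ≤ n) (τ₀ δ : ℝ)
    (h1 : 0 < τ₀) (h2 : τ₀ < 1 / (2 * (n : ℝ))) (hδ : 0 < δ) :
    ∃ ν : ℝ, τ₀ < ν ∧ ν < 1 / (2 * (n : ℝ)) ∧ ∀ X : ℝ, 1 ≤ X →
      muGL n (K0 n X ν) - muGL n (K0 n X τ₀) <
        ENNReal.ofReal δ * muGL n (K0 n X τ₀) := by
  have hn0 : (0 : ℝ) < 2 * n := by
    have : 0 < n := by omega
    positivity
  have hτ₀ : τ₀ * (2 * n) < 1 := (lt_div_iff₀ hn0).1 h2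
  have hev : ∀ᶠ ν in 𝓝[>] τ₀, τ₀ < ν ∧ ν < 1 / (2 * (n : ℝ)) ∧ ∀ h ∈ closedCube n,
      pulledDensity n ν h < (1 + δ / 2) * pulledDensity n τ₀ h :=
    (eventually_mem_nhdsWithin.and (nhdsWithin_le_nhds
      ((eventually_lt_nhds h2).and (eventually_pulledDensity_le h1 hτ₀ (half_pos hδ)))))
  obtain ⟨ν, hν1, hν2, hν⟩ := hev.exists
  refine ⟨ν, hν1, hν2, fun X hX => ?_⟩
  have hle : muGL n (K0 n X ν) ≤ ENNReal.ofReal (1 + δ / 2) * muGL n (K0 n X τ₀) := by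
    rw [muGL_K0_eq_lintegral (h1.trans hν1) ((lt_div_iff₀ hn0).1 hν2) hX,
      muGL_K0_eq_lintegral h1 hτ₀ hX, ← lintegral_const_mul' _ _ ENNReal.ofReal_ne_top]
    refine setLIntegral_mono' (isOpen_openBox n X).measurableSet fun h hh => ?_
    rw [← ENNReal.ofReal_mul (by positivity)]
    exact ENNReal.ofReal_le_ofReal (hν h (openBox_subset_closedCube n hX hh)).le
  rw [ENNReal.ofReal_add zero_le_one (half_pos hδ).le, ENNReal.ofReal_one, add_mul,
    one_mul] at hle
  refine (tsub_le_iff_left.2 hle).trans_lt ?_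
  exact ENNReal.mul_lt_mul_left (muGL_K0_pos h1 hτ₀ hX).ne' (muGL_K0_lt_top h1 hτ₀ hX).ne
    ((ENNReal.ofReal_lt_ofReal_iff hδ).2 (half_lt_self hδ))
end
end

section
/- For every integer r ≥ 1 and all real tuples β = (β₁, …, β_{r+1}) ∈ ℝ^{r+1} and t = (t₁, …, t_r) ∈ ℝ^r, one has the inequality Σ_{i=1}^{r+1} Σ_{j=1}^{r} |β_i − t_j| ≥ Σ_{1 ≤ i < j ≤ r} |t_i − t_j| + Σ_{1 ≤ i < j ≤ r+1} |β_i − β_j|. -/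
open MeasureTheory in
/-- Layer-cake form of the distance on `ℝ`: `|x - y|` is the measure of the set of levels `s`
that separate `x` from `y`. -/
theorem separation_eq_indicator (x y : ℝ) :
    (fun s : ℝ => (if s < x then (1 : ℝ) else 0) + (if s < y then 1 else 0)
      - 2 * (if s < x then 1 else 0) * (if s < y then 1 else 0)) =
    (Set.Ico (min x y) (max x y)).indicator 1 := by
  funext s
  simp only [Set.indicator_apply, Set.mem_Ico, min_le_iff, lt_max_iff, Pi.one_apply]
  by_cases hx : s < x <;> by_cases hy : s < y <;> simp [hx, hy, not_le.2, not_lt.1]; norm_num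

open MeasureTheory in
theorem integrable_separation (x y : ℝ) :
    Integrable (fun s : ℝ => (if s < x then (1 : ℝ) else 0) + (if s < y then 1 else 0)
      - 2 * (if s < x then 1 else 0) * (if s < y then 1 else 0)) := by
  rw [separation_eq_indicator]
  exact (integrable_indicator_iff measurableSet_Ico).2 (integrableOn_const (by simp))

open MeasureTheory in
theorem integral_separation (x y : ℝ) :
    ∫ s : ℝ, ((if s < x then (1 : ℝ) else 0) + (if s < y then 1 else 0)
      - 2 * (if s < x then 1 else 0) * (if s < y then 1 else 0)) = |x - y| := by
  rw [separation_eq_indicator, integral_indicator_one measurableSet_Ico, Real.volume_real_Ico,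
    max_sub_min_eq_abs, max_eq_left (abs_nonneg _), abs_sub_comm]

theorem sum_sum_eq_two_mul_sum_lt {ι R : Type*} [Fintype ι] [LinearOrder ι] [CommSemiring R]
    (f : ι → ι → R) (hsymm : ∀ i j, f i j = f j i) (hdiag : ∀ i, f i i = 0) :
    ∑ i, ∑ j, f i j = 2 * ∑ i, ∑ j, if i < j then f i j else 0 := by
  have hsplit : ∀ i j, f i j = (if i < j then f i j else 0) + if j < i then f j i else 0 := by
    intro i j
    rcases lt_trichotomy i j with h | rfl | h
    · simp [h, h.not_gt]
    · simp [hdiag]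
    · simp [h, h.not_gt, hsymm i j]
  calc ∑ i, ∑ j, f i j
      = ∑ i, ∑ j, ((if i < j then f i j else 0) + if j < i then f j i else 0) := by
        simp_rw [← hsplit]
    _ = 2 * ∑ i, ∑ j, if i < j then f i j else 0 := by
        simp_rw [Finset.sum_add_distrib]
        rw [Finset.sum_comm (f := fun i j => if j < i then f j i else 0), two_mul]

theorem sum_sum_add_sub_two_mul {ι κ : Type*} [Fintype ι] [Fintype κ] (p : ι → ℝ) (q : κ → ℝ) :
    ∑ i, ∑ j, (p i + q j - 2 * p i * q j) =
      Fintype.card κ * ∑ i, p i + Fintype.card ι * ∑ j, q j - 2 * (∑ i, p i) * ∑ j, q j := by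
  simp only [Finset.sum_sub_distrib, Finset.sum_add_distrib, Finset.sum_const, Finset.card_univ,
    nsmul_eq_mul, ← Finset.mul_sum, ← Finset.sum_mul]

open MeasureTheory in
theorem integral_sum_sum_separation {ι κ : Type*} [Fintype ι] [Fintype κ]
    (x : ι → ℝ) (y : κ → ℝ) :
    Integrable (fun s : ℝ => ∑ i, ∑ j, ((if s < x i then (1 : ℝ) else 0)
      + (if s < y j then 1 else 0)
      - 2 * (if s < x i then 1 else 0) * (if s < y j then 1 else 0))) ∧
    ∫ s : ℝ, ∑ i, ∑ j, ((if s < x i then (1 : ℝ) else 0) + (if s < y j then 1 else 0)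
      - 2 * (if s < x i then 1 else 0) * (if s < y j then 1 else 0)) =
      ∑ i, ∑ j, |x i - y j| := by
  have hrow : ∀ i, Integrable (fun s : ℝ => ∑ j, ((if s < x i then (1 : ℝ) else 0)
      + (if s < y j then 1 else 0)
      - 2 * (if s < x i then 1 else 0) * (if s < y j then 1 else 0))) := fun i =>
    integrable_finsetSum _ fun j _ => integrable_separation (x i) (y j)
  refine ⟨integrable_finsetSum _ fun i _ => hrow i, ?_⟩
  rw [integral_finsetSum _ fun i _ => hrow i]
  refine Finset.sum_congr rfl fun i _ => ?_
  rw [integral_finsetSum _ fun j _ => integrable_separation (x i) (y j)]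
  exact Finset.sum_congr rfl fun j _ => integral_separation (x i) (y j)

/-- Non-negativity of the exponent in the exponential factor `E(t,β)` from the proof of
Lemma 6.6: for all real tuples `β ∈ ℝ^{r+1}` and `t ∈ ℝ^r`,
`Σ_{i,j} |β_i − t_j| ≥ Σ_{i<j} |t_i − t_j| + Σ_{i<j} |β_i − β_j|`. -/
theorem exponent_nonneg (r : ℕ) (hr : 1 ≤ r) (β : Fin (r + 1) → ℝ) (t : Fin r → ℝ) :
    (∑ i, ∑ j, if i < j then |t i - t j| else 0) +
      (∑ i, ∑ j, if i < j then |β i - β j| else 0) ≤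
    ∑ i, ∑ j, |β i - t j| := by
  have ht := sum_sum_eq_two_mul_sum_lt (fun i j => |t i - t j|)
    (fun i j => abs_sub_comm _ _) (by simp)
  have hβ := sum_sum_eq_two_mul_sum_lt (fun i j => |β i - β j|)
    (fun i j => abs_sub_comm _ _) (by simp)
  obtain ⟨htt, htt'⟩ := integral_sum_sum_separation t t
  obtain ⟨hββ, hββ'⟩ := integral_sum_sum_separation β β
  obtain ⟨hβt, hβt'⟩ := integral_sum_sum_separation β t
  suffices h : (∑ i, ∑ j, |t i - t j|) + ∑ i, ∑ j, |β i - β j| ≤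
      2 * ∑ i, ∑ j, |β i - t j| by linarith
  rw [← htt', ← hββ', ← hβt', ← MeasureTheory.integral_add htt hββ,
    ← MeasureTheory.integral_const_mul]
  refine MeasureTheory.integral_mono (htt.add hββ) (hβt.const_mul 2) fun s => ?_
  simp only [sum_sum_add_sub_two_mul (fun i => if s < t i then (1 : ℝ) else 0),
    sum_sum_add_sub_two_mul (fun i => if s < β i then (1 : ℝ) else 0), Fintype.card_fin,
    Finset.sum_boole]
  set a := (Finset.univ.filter fun i => s < t i).card
  set b := (Finset.univ.filter fun i => s < β i).card
  -- The difference of the two sides is `2 * (b - a) * (b - a - 1)`, with `a` and `b` integers.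
  have key : (0 : ℝ) ≤ ((b : ℝ) - a) * (b - a - 1) := by
    have hint : (0 : ℤ) ≤ ((b : ℤ) - a) * (b - a - 1) := by
      rcases le_or_gt ((b : ℤ) - a) 0 with h | h
      · exact mul_nonneg_of_nonpos_of_nonpos h (by omega)
      · exact mul_nonneg h.le (by omega)
    exact_mod_cast hint
  push_cast
  nlinarith [key]
end

section
/- Fix an integer n ≥ 1. There exists ε > 0 (indeed ε = 1/2 works) with the following property: if γ is an n×n real matrix all of whose entries are integers, and γ = u₁·g·u₂ where u₁ and u₂ are upper-triangular real matrices with all diagonal entries equal to 1, and g is an n×n real matrix with |g_{ij} − δ_{ij}| < ε for all i, j (δ_{ij} the Kronecker delta), then γ itself is upper triangular with all diagonal entries equal to 1. -/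
/-- If `a` is the `i`-th row of an upper-triangular unipotent matrix and `b` vanishes past `i`,
only the diagonal term of their dot product survives. -/
lemma sum_mul_eq_of_row_unipotent {ι R : Type*} [Fintype ι] [LinearOrder ι] [Semiring R]
    {a b : ι → R} {i : ι} (ha : ∀ k < i, a k = 0) (hi : a i = 1) (hb : ∀ k, i < k → b k = 0) :
    ∑ k, a k * b k = b i := by
  rw [Fintype.sum_eq_single i, hi, one_mul]
  intro k hk
  rcases hk.lt_or_gt with h | h
  · rw [ha k h, zero_mul]
  · rw [hb k h, mul_zero]

/-- If `a` vanishes before `j` and `b` is the `j`-th column of an upper-triangular unipotent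
matrix, only the diagonal term of their dot product survives. -/
lemma sum_mul_eq_of_column_unipotent {ι R : Type*} [Fintype ι] [LinearOrder ι] [Semiring R]
    {a b : ι → R} {j : ι} (ha : ∀ k < j, a k = 0) (hj : b j = 1) (hb : ∀ k, j < k → b k = 0) :
    ∑ k, a k * b k = a j := by
  rw [Fintype.sum_eq_single j, hj, mul_one]
  intro k hk
  rcases hk.lt_or_gt with h | h
  · rw [ha k h, zero_mul]
  · rw [hb k h, mul_zero]

lemma Int.cast_eq_cast_of_abs_sub_lt_one {m k : ℤ} (h : |(m : ℝ) - k| < 1) : (m : ℝ) = k := by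
  have h' : |m - k| < 1 := by exact_mod_cast h
  rw [sub_eq_zero.mp (Int.abs_lt_one_iff.mp h')]

/-- Equation (7.2) of the paper, nontrivial inclusion: there exists `ε > 0` such that if
an integer matrix `γ` factors as `γ = u₁·g·u₂` with `u₁, u₂` upper-triangular unipotent
real matrices and `g` within `ε` of the identity entrywise, then `γ` is itself
upper triangular with all diagonal entries equal to `1`. -/
theorem NUN_inter_integral (n : ℕ) (hn : 1 ≤ n) :
    ∃ ε : ℝ, 0 < ε ∧ ∀ γ u₁ g u₂ : Matrix (Fin n) (Fin n) ℝ,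
      (∀ i j, ∃ m : ℤ, γ i j = (m : ℝ)) →
      (∀ i j : Fin n, j < i → u₁ i j = 0) → (∀ i, u₁ i i = 1) →
      (∀ i j : Fin n, j < i → u₂ i j = 0) → (∀ i, u₂ i i = 1) →
      (∀ i j, |g i j - (if i = j then 1 else 0)| < ε) →
      γ = u₁ * g * u₂ →
      (∀ i j : Fin n, j < i → γ i j = 0) ∧ ∀ i, γ i i = 1 := by
  refine ⟨1, one_pos, fun γ u₁ g u₂ hγ_int hu₁ hd₁ hu₂ hd₂ hg hγ => ?_⟩
  have key : ∀ j i : Fin n, j ≤ i →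
      γ i j = (if i = j then 1 else 0) ∧ g i j = (if i = j then 1 else 0) := by
    intro j
    induction j using WellFoundedLT.induction with
    | ind j ihj =>
      have hcol : ∀ i, j ≤ i → (g * u₂) i j = g i j := fun i hij =>
        sum_mul_eq_of_column_unipotent (a := fun k => g i k) (b := fun k => u₂ k j)
          (fun k hk => by
            rw [(ihj k hk i (hk.le.trans hij)).2, if_neg (hk.trans_le hij).ne'])
          (hd₂ j) (fun k hk => hu₂ k j hk)
      intro i
      induction i using WellFoundedGT.induction with
      | ind i ihi =>
        intro hij
        have hγg : γ i j = g i j := by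
          rw [hγ, Matrix.mul_assoc, ← hcol i hij]
          refine sum_mul_eq_of_row_unipotent (a := fun k => u₁ i k)
            (b := fun k => (g * u₂) k j) (fun k hk => hu₁ i k hk) (hd₁ i) (fun k hk => ?_)
          have hjk := hij.trans_lt hk
          rw [hcol k hjk.le, (ihi k hk hjk.le).2, if_neg hjk.ne']
        have hγδ : γ i j = (if i = j then 1 else 0) := by
          obtain ⟨m, hm⟩ := hγ_int i j
          have h := hg i j
          rw [← hγg, hm] at h
          have := Int.cast_eq_cast_of_abs_sub_lt_one (m := m) (k := if i = j then 1 else 0)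
            (by simpa using h)
          simpa [hm] using this
        exact ⟨hγδ, hγg ▸ hγδ⟩
  exact ⟨fun i j hij => by rw [(key j i hij.le).1, if_neg hij.ne'],
    fun i => by rw [(key i i le_rfl).1, if_pos rfl]⟩
end
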